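/- arXiv:1410.8430 — 8 statements merged into one kernel-verified Lean document; each statement's English description precedes it below -/
import Mathlib

section
/- Let G be a simple graph on a (possibly infinite) vertex set V and let r be a natural number. Suppose that for every finite subset F ⊆ V there exists a subset A ⊆ F such that A is an independent set of G and |F ∖ A| ≤ r. Then there exists a subset C ⊆ V with |C| ≤ r such that V ∖ C is an independent set of G. -/
/-- Compactness for covers of bounded size: if the restriction of a relation to every finite set
is covered by at most `r` points, then so is the whole relation. -/
theorem exists_cover_card_le_of_forall_finset {V : Type*} [DecidableEq V] (r : ℕ)
    (R : V → V → Prop)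
    (h : ∀ F : Finset V, ∃ C : Finset V, C.card ≤ r ∧
      ∀ a ∈ F, ∀ b ∈ F, R a b → a ∈ C ∨ b ∈ C) :
    ∃ C : Finset V, C.card ≤ r ∧ ∀ a b, R a b → a ∈ C ∨ b ∈ C := by
  induction r generalizing R with
  | zero =>
    refine ⟨∅, le_rfl, fun a b hab => ?_⟩
    obtain ⟨C, hC, hcov⟩ := h {a, b}
    obtain rfl : C = ∅ := Finset.card_eq_zero.mp (Nat.le_zero.mp hC)
    exact hcov a (by simp) b (by simp) hab
  | succ r ih =>
    by_cases hR : ∃ u v, R u v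
    · obtain ⟨u, v, huv⟩ := hR
      have key : ∃ w, ∀ F : Finset V, ∃ C : Finset V, C.card ≤ r ∧
          ∀ a ∈ F, ∀ b ∈ F, (R a b ∧ a ≠ w ∧ b ≠ w) → a ∈ C ∨ b ∈ C := by
        by_contra hbad
        rw [not_exists] at hbad
        obtain ⟨F₁, hF₁⟩ := not_forall.mp (hbad u)
        obtain ⟨F₂, hF₂⟩ := not_forall.mp (hbad v)
        obtain ⟨C, hC, hcov⟩ := h (F₁ ∪ F₂ ∪ {u, v})
        rcases hcov u (by simp) v (by simp) huv with hu | hv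
        · refine hF₁ ⟨C.erase u, by rw [Finset.card_erase_of_mem hu]; omega, ?_⟩
          rintro a ha b hb ⟨hab, hau, hbu⟩
          simpa [hau, hbu] using hcov a (by simp [ha]) b (by simp [hb]) hab
        · refine hF₂ ⟨C.erase v, by rw [Finset.card_erase_of_mem hv]; omega, ?_⟩
          rintro a ha b hb ⟨hab, hav, hbv⟩
          simpa [hav, hbv] using hcov a (by simp [ha]) b (by simp [hb]) hab
      obtain ⟨w, hw⟩ := key
      obtain ⟨C, hC, hcov⟩ := ih _ hw
      refine ⟨insert w C, (Finset.card_insert_le w C).trans (by omega), fun a b hab => ?_⟩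
      have := hcov a b
      simp only [Finset.mem_insert]
      tauto
    · exact ⟨∅, by simp, fun a b hab => (hR ⟨a, b, hab⟩).elim⟩

/-- If every finite subset `F` of vertices contains an independent subset `A`
with `|F \ A| ≤ r`, then there is a set `C` of at most `r` vertices whose
complement is independent. -/
theorem stmt_0 {V : Type*} [DecidableEq V] (G : SimpleGraph V) (r : ℕ)
    (h : ∀ F : Finset V, ∃ A : Finset V, A ⊆ F ∧
      (∀ a ∈ A, ∀ b ∈ A, a ≠ b → ¬ G.Adj a b) ∧ (F \ A).card ≤ r) :
    ∃ C : Finset V, C.card ≤ r ∧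
      ∀ a b : V, a ∉ C → b ∉ C → a ≠ b → ¬ G.Adj a b := by
  obtain ⟨C, hC, hcov⟩ := exists_cover_card_le_of_forall_finset r G.Adj fun F => by
    obtain ⟨A, -, hA, hcard⟩ := h F
    refine ⟨F \ A, hcard, fun a ha b hb hab => ?_⟩
    by_contra! hn
    simp only [Finset.mem_sdiff, ha, hb, true_and, not_not] at hn
    exact hA a hn.1 b hn.2 hab.ne hab
  exact ⟨C, hC, fun a b ha hb _ hab => (hcov a b hab).elim ha hb⟩
end

section
/- Let G be a simple graph on a (possibly infinite) vertex set V and let r be a natural number. Suppose that for every finite subset F ⊆ V there exists a subset A ⊆ F such that A is an independent set of G and |F ∖ A| ≤ r. Then the set of vertices of V that have at least r+1 neighbors in G is finite and has at most r elements. -/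
/-- If every finite subset `F` of vertices contains an independent subset `A`
with `|F \ A| ≤ r`, then the set of vertices having at least `r + 1` neighbors
is finite and has at most `r` elements. -/
theorem stmt_1 {V : Type*} [DecidableEq V] (G : SimpleGraph V) (r : ℕ)
    (h : ∀ F : Finset V, ∃ A : Finset V, A ⊆ F ∧
      (∀ a ∈ A, ∀ b ∈ A, a ≠ b → ¬ G.Adj a b) ∧ (F \ A).card ≤ r) :
    {v : V | ∃ s : Finset V, r + 1 ≤ s.card ∧ ∀ w ∈ s, G.Adj v w}.Finite ∧
    {v : V | ∃ s : Finset V, r + 1 ≤ s.card ∧ ∀ w ∈ s, G.Adj v w}.ncard ≤ r := by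
  set S := {v : V | ∃ s : Finset V, r + 1 ≤ s.card ∧ ∀ w ∈ s, G.Adj v w}
  have card_le : ∀ T : Finset V, (T : Set V) ⊆ S → T.card ≤ r := by
    intro T hT
    have hN : ∀ v, ∃ s : Finset V, v ∈ T → r + 1 ≤ s.card ∧ ∀ w ∈ s, G.Adj v w := by
      intro v
      by_cases hv : v ∈ T
      · obtain ⟨s, hs⟩ := hT hv
        exact ⟨s, fun _ => hs⟩
      · exact ⟨∅, fun hv' => absurd hv' hv⟩
    choose N hN using hN
    obtain ⟨A, -, hA, hcard⟩ := h (T ∪ T.biUnion N)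
    refine (Finset.card_le_card fun v hv => ?_).trans hcard
    refine Finset.mem_sdiff.2 ⟨Finset.mem_union_left _ hv, fun hvA => ?_⟩
    have hsub : N v ⊆ (T ∪ T.biUnion N) \ A := fun w hw =>
      Finset.mem_sdiff.2 ⟨Finset.mem_union_right _ (Finset.mem_biUnion.2 ⟨v, hv, hw⟩),
        fun hwA => hA v hvA w hwA ((hN v hv).2 w hw).ne ((hN v hv).2 w hw)⟩
    have := Finset.card_le_card hsub
    have := (hN v hv).1
    omega
  have hfin : S.Finite := by
    by_contra hinf
    obtain ⟨T, hT, hTcard⟩ := Set.Infinite.exists_subset_card_eq hinf (r + 1)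
    have := card_le T hT
    omega
  refine ⟨hfin, ?_⟩
  rw [Set.ncard_eq_toFinset_card S hfin]
  exact card_le _ (by simp)
end

section
/- Let f : ℕ → ℂ be a function and r a natural number. Suppose that for every finite subset F ⊆ ℕ there exists a subset F′ ⊆ F such that f is integral on F′ and |F ∖ F′| ≤ r. Then there exists a finite subset E ⊆ ℕ with |E| ≤ r such that f is integral on ℕ ∖ E. -/
/-- A set of naturals all of whose finite subsets have at most `r` elements is a finset with at
most `r` elements. -/
theorem exists_finset_card_le_of_forall_finset (B : Set ℕ) (r : ℕ)
    (hB : ∀ T : Finset ℕ, ↑T ⊆ B → T.card ≤ r) :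
    ∃ E : Finset ℕ, ↑E = B ∧ E.card ≤ r := by
  have hfin : B.Finite := by
    by_contra hinf
    obtain ⟨T, hTB, hT⟩ := Set.Infinite.exists_subset_card_eq hinf (r + 1)
    have := hB T hTB
    omega
  exact ⟨hfin.toFinset, hfin.coe_toFinset, hB _ hfin.coe_toFinset.subset⟩

/-- If every finite subset `F ⊆ ℕ` has a subset `F'` on which `f` is integral
(all pairwise differences of values are integers) with `|F \ F'| ≤ r`, then
there is a finite set `E` with `|E| ≤ r` such that `f` is integral on `ℕ \ E`. -/
theorem stmt_3 (f : ℕ → ℂ) (r : ℕ)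
    (h : ∀ F : Finset ℕ, ∃ F' : Finset ℕ, F' ⊆ F ∧
      (∀ i ∈ F', ∀ j ∈ F', ∃ z : ℤ, f i - f j = (z : ℂ)) ∧ (F \ F').card ≤ r) :
    ∃ E : Finset ℕ, E.card ≤ r ∧
      ∀ i j : ℕ, i ∉ E → j ∉ E → ∃ z : ℤ, f i - f j = (z : ℂ) := by
  obtain ⟨A, -, hA, hcard⟩ := h (Finset.range (2 * r + 1))
  have hAcard : r < A.card := by
    have := Finset.le_card_sdiff A (Finset.range (2 * r + 1))
    rw [Finset.card_range] at this
    omega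
  obtain ⟨a, ha⟩ : A.Nonempty := Finset.card_pos.mp (by omega)
  obtain ⟨E, hE, hEr⟩ := exists_finset_card_le_of_forall_finset
    {i | ¬ ∃ z : ℤ, f i - f a = (z : ℂ)} r (by
      intro T hT
      by_contra! hTr
      obtain ⟨G, -, hG, hGr⟩ := h (A ∪ T)
      have meets : ∀ S : Finset ℕ, S ⊆ A ∪ T → r < S.card → ∃ x ∈ S, x ∈ G := by
        intro S hS hSr
        by_contra! hSG
        have : S ⊆ (A ∪ T) \ G := fun x hx => Finset.mem_sdiff.mpr ⟨hS hx, hSG x hx⟩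
        have := Finset.card_le_card this
        omega
      obtain ⟨x, hxA, hxG⟩ := meets A Finset.subset_union_left hAcard
      obtain ⟨y, hyT, hyG⟩ := meets T Finset.subset_union_right hTr
      obtain ⟨m, hm⟩ := hG y hyG x hxG
      obtain ⟨n, hn⟩ := hA x hxA a ha
      exact hT hyT ⟨m + n, by push_cast; rw [← hm, ← hn]; ring⟩)
  have integral_of_notMem : ∀ i ∉ E, ∃ z : ℤ, f i - f a = (z : ℂ) := by
    intro i hi
    by_contra hia
    have : i ∈ (E : Set ℕ) := hE ▸ hia
    exact hi this
  refine ⟨E, hEr, fun i j hi hj => ?_⟩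
  obtain ⟨m, hm⟩ := integral_of_notMem i hi
  obtain ⟨n, hn⟩ := integral_of_notMem j hj
  exact ⟨m - n, by push_cast; rw [← hm, ← hn]; ring⟩
end

section
/- Let f : ℕ → ℂ be a function whose range is infinite, and let n ≥ 1 be a natural number. Then the set of tuples {(f(φ(0)), f(φ(1)), …, f(φ(n−1))) : φ an injective map from {0,1,…,n−1} to ℕ} is Zariski dense in ℂⁿ; that is, every polynomial p ∈ ℂ[x₀,…,x_{n−1}] satisfying p(f(φ(0)),…,f(φ(n−1))) = 0 for all injective maps φ : {0,…,n−1} → ℕ is the zero polynomial. -/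
/-- If `f : ℕ → ℂ` has infinite range and `n ≥ 1`, then the set of tuples
`(f (φ 0), …, f (φ (n-1)))` over injective `φ : Fin n → ℕ` is Zariski dense in
`ℂⁿ`: every polynomial vanishing on all such tuples is zero. -/
theorem stmt_4 (f : ℕ → ℂ) (hf : (Set.range f).Infinite) (n : ℕ) (hn : 1 ≤ n)
    (p : MvPolynomial (Fin n) ℂ)
    (hp : ∀ φ : Fin n → ℕ, Function.Injective φ →
      MvPolynomial.eval (fun i => f (φ i)) p = 0) :
    p = 0 := by
  -- Split the range of `f` into disjoint infinite sets, one for each coordinate.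
  let g : ℕ ↪ Set.range f := hf.natEmbedding
  have hg : Function.Injective fun m => (g m : ℂ) :=
    Subtype.val_injective.comp g.injective
  refine MvPolynomial.funext_set
    (fun i : Fin n => Set.range fun k : ℕ => (g (Nat.pair i k) : ℂ))
    (fun i => Set.infinite_range_of_injective fun a b hab =>
      (Nat.pair_eq_pair.1 (hg hab)).2) fun x hx => ?_
  choose k hk using fun i => hx i (Set.mem_univ i)
  choose φ hφ using fun i : Fin n => (g (Nat.pair i (k i))).2
  have hφx : (fun i => f (φ i)) = x := funext fun i => (hφ i).trans (hk i)
  have hinj : Function.Injective φ := fun i j hij =>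
    Fin.ext (Nat.pair_eq_pair.1 (hg ((hφ i).symm.trans ((congrArg f hij).trans (hφ j))))).1
  rw [← hφx, hp φ hinj, map_zero]
end

section
/- Let r be a natural number and let f : {1, 2, …, 2r+2} → ℤ be a function such that f(2i) > f(2i−1) for every i with 1 ≤ i ≤ r+1. Define g(k) = f(k) − k for 1 ≤ k ≤ 2r+2. Then g has no strictly decreasing subsequence of length r+2; that is, there do not exist indices k₁ < k₂ < … < k_{r+2} in {1,…,2r+2} with g(k₁) > g(k₂) > … > g(k_{r+2}). -/
/-- Let `f` be integer valued on `{1, …, 2r+2}` with `f (2i) > f (2i - 1)` for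
`1 ≤ i ≤ r + 1`, and let `g k = f k - k`. Then there are no indices
`k₁ < ⋯ < k_{r+2}` in `{1, …, 2r+2}` along which `g` is strictly decreasing. -/
theorem stmt_5 (r : ℕ) (f : ℕ → ℤ)
    (hf : ∀ i : ℕ, 1 ≤ i → i ≤ r + 1 → f (2 * i - 1) < f (2 * i)) :
    ¬ ∃ k : Fin (r + 2) → ℕ,
      (∀ a : Fin (r + 2), 1 ≤ k a ∧ k a ≤ 2 * r + 2) ∧
      StrictMono k ∧
      (∀ a b : Fin (r + 2), a < b →
        f (k b) - (k b : ℤ) < f (k a) - (k a : ℤ)) := by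
  rintro ⟨k, hk, hmono, hdec⟩
  have hmaps : ∀ a ∈ (Finset.univ : Finset (Fin (r + 2))),
      (k a - 1) / 2 ∈ Finset.range (r + 1) := by
    intro a _
    have := hk a
    rw [Finset.mem_range]
    omega
  obtain ⟨a, -, b, -, hne, hab⟩ :=
    Finset.exists_ne_map_eq_of_card_lt_of_maps_to (by simp) hmaps
  wlog hlt : a < b generalizing a b
  · exact this b a hne.symm hab.symm (lt_of_le_of_ne (not_lt.mp hlt) hne.symm)
  have hkab := hmono hlt
  have hka := hk a
  have hkb := hk b
  have hg := hdec a b hlt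
  have hpair := hf ((k a - 1) / 2 + 1) (by omega) (by omega)
  have ha : 2 * ((k a - 1) / 2 + 1) - 1 = k a := by omega
  have hb : 2 * ((k a - 1) / 2 + 1) = k b := by omega
  rw [ha, hb] at hpair
  omega
end

section
/- Let ≺ be a linear order on ℕ, let r be a natural number, and let f : ℕ → ℤ be a function whose range is finite. Suppose there is no chain t₁ ≺ t₂ ≺ … ≺ t_{2r+2} of 2r+2 elements of ℕ such that f(t_{2i−1}) < f(t_{2i}) for every i with 1 ≤ i ≤ r+1. Then f is locally constant with respect to ≺, i.e., there exists a finite partition ℕ = S₁ ⊔ … ⊔ S_t compatible with ≺ such that f is constant on each S_i. -/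
/-- `HasAscents f m p`: there is a strictly increasing chain of `2 * m` elements satisfying `p`
that splits into `m` consecutive pairs along each of which `f` increases. -/
def HasAscents {α : Type*} [LT α] (f : α → ℤ) (m : ℕ) (p : α → Prop) : Prop :=
  ∃ t : ℕ → α, (∀ i j, i < j → j < 2 * m → t i < t j) ∧
    (∀ i < m, f (t (2 * i)) < f (t (2 * i + 1))) ∧ ∀ i < 2 * m, p (t i)

/-- `AlternatesTo f k a`: there is a strictly increasing chain of `k + 1` elements ending at `a`
along which consecutive values of `f` are distinct. -/
inductive AlternatesTo {α : Type*} [LT α] (f : α → ℤ) : ℕ → α → Prop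
  | zero (a : α) : AlternatesTo f 0 a
  | succ {k : ℕ} {a b : α} : AlternatesTo f k a → a < b → f a ≠ f b → AlternatesTo f (k + 1) b

theorem HasAscents.mono {α : Type*} [LT α] {f : α → ℤ} {m : ℕ} {p q : α → Prop}
    (h : HasAscents f m p) (hpq : ∀ a, p a → q a) : HasAscents f m q := by
  obtain ⟨t, h1, h2, h3⟩ := h
  exact ⟨t, h1, h2, fun i hi => hpq _ (h3 i hi)⟩

theorem HasAscents.succ {α : Type*} [LinearOrder α] {f : α → ℤ} {m : ℕ} {a b : α}
    (h : HasAscents f m (· < a)) (hab : a < b) (hf : f a < f b) :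
    HasAscents f (m + 1) (· ≤ b) := by
  obtain ⟨t, h1, h2, h3⟩ := h
  refine ⟨fun i => if i < 2 * m then t i else if i = 2 * m then a else b, ?_, ?_, ?_⟩
  · intro i j hij hj
    have := h1 i j hij
    have := h3 i
    dsimp only
    split_ifs <;> first | omega | grind
  · intro i hi
    have := h2 i
    dsimp only
    split_ifs <;> omega
  · intro i hi
    have := h3 i
    dsimp only
    split_ifs <;> grind

theorem AlternatesTo.exists_hasAscents {α : Type*} [LinearOrder α] {f : α → ℤ} {s : Finset ℤ}
    (hs : ∀ a, f a ∈ s) {k : ℕ} {a : α} (h : AlternatesTo f k a) :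
    ∃ m, (HasAscents f m (· < a) ∧ k ≤ (s.card + 2) * m + (s.filter (f a < ·)).card) ∨
      (HasAscents f (m + 1) (· ≤ a) ∧ k ≤ (s.card + 2) * m + s.card + 1) := by
  induction h with
  | zero a => exact ⟨0, Or.inl ⟨⟨fun _ => a, by simp, by simp, by simp⟩, by simp⟩⟩
  | @succ k a b _ hab hne ih =>
    obtain ⟨m, ⟨hm, hk⟩ | ⟨hm, hk⟩⟩ := ih
    · rcases lt_or_gt_of_ne hne with hf | hf
      · have := Finset.card_filter_le s (f a < ·)
        exact ⟨m, Or.inr ⟨hm.succ hab hf, by omega⟩⟩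
      · have : (s.filter (f a < ·)).card < (s.filter (f b < ·)).card := by
          apply Finset.card_lt_card
          rw [Finset.ssubset_iff_of_subset]
          · exact ⟨f a, by simp [hs, hf], by simp⟩
          · intro x hx
            simp only [Finset.mem_filter] at hx ⊢
            exact ⟨hx.1, hf.trans hx.2⟩
        exact ⟨m, Or.inl ⟨hm.mono fun _ hx => hx.trans hab, by omega⟩⟩
    · exact ⟨m + 1, Or.inl ⟨hm.mono fun _ hx => lt_of_le_of_lt hx hab, by
        rw [mul_add]; omega⟩⟩

/-- A finite-range function with boundedly many disjoint ascents factors through a bounded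
monotone function to `ℕ`. -/
theorem exists_monotone_of_not_hasAscents {α : Type*} [LinearOrder α] {f : α → ℤ}
    (hfin : (Set.range f).Finite) {r : ℕ} (h : ∀ m p, HasAscents f m p → m ≤ r) :
    ∃ (g : α → ℕ) (B : ℕ), Monotone g ∧ (∀ a, g a < B) ∧ ∀ a b, g a = g b → f a = f b := by
  classical
  set s := hfin.toFinset
  have hs : ∀ a, f a ∈ s := by simp [s]
  set B := (s.card + 2) * r + s.card + 1
  have hB : ∀ k a, AlternatesTo f k a → k ≤ B := by
    intro k a hk
    have := Finset.card_filter_le s (f a < ·)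
    obtain ⟨m, ⟨hm, hk⟩ | ⟨hm, hk⟩⟩ := hk.exists_hasAscents hs
    all_goals
      have hmr := h _ _ hm
      have := Nat.mul_le_mul_left (s.card + 2) (show m ≤ r by omega)
      omega
  let g : α → ℕ := fun a => Nat.findGreatest (fun k => ∃ x ≤ a, AlternatesTo f k x) B
  have hg : ∀ a, ∃ x ≤ a, AlternatesTo f (g a) x := fun a =>
    Nat.findGreatest_spec (P := fun k => ∃ x ≤ a, AlternatesTo f k x) (Nat.zero_le B)
      ⟨a, le_rfl, .zero a⟩
  have hle : ∀ k a x, x ≤ a → AlternatesTo f k x → k ≤ g a := fun k a x hx hk =>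
    Nat.le_findGreatest (hB k x hk) ⟨x, hx, hk⟩
  have heq : ∀ a x, x ≤ a → AlternatesTo f (g a) x → f x = f a := by
    intro a x hx hk
    by_contra hne
    have hlt : x < a := lt_of_le_of_ne hx fun hxa => hne (congrArg f hxa)
    have := hle _ a a le_rfl (hk.succ hlt hne)
    omega
  have key : ∀ a b, a ≤ b → g a = g b → f a = f b := by
    intro a b hab hgab
    obtain ⟨x, hx, hk⟩ := hg a
    exact (heq a x hx hk).symm.trans (heq b x (hx.trans hab) (hgab ▸ hk))
  refine ⟨g, B + 1, ?_, fun a => Nat.lt_succ_of_le (Nat.findGreatest_le B), ?_⟩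
  · intro a b hab
    obtain ⟨x, hx, hk⟩ := hg a
    exact hle _ b x (hx.trans hab) hk
  · intro a b hgab
    rcases le_total a b with hab | hab
    · exact key a b hab hgab
    · exact (key b a hab hgab.symm).symm


/-- Let `prec` be a (strict) linear order on `ℕ`, and let `f : ℕ → ℤ` have
finite range. If there is no `prec`-chain `t₁ ≺ ⋯ ≺ t_{2r+2}` with
`f t_{2i-1} < f t_{2i}` for `1 ≤ i ≤ r + 1`, then `f` is locally constant with
respect to `prec`: there is a finite partition of `ℕ` compatible with `prec`
such that `f` is constant on each part. -/
theorem stmt_6 (prec : ℕ → ℕ → Prop) (hprec : IsStrictTotalOrder ℕ prec)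
    (r : ℕ) (f : ℕ → ℤ) (hfin : (Set.range f).Finite)
    (h : ¬ ∃ t : Fin (2 * r + 2) → ℕ,
      (∀ a b : Fin (2 * r + 2), a < b → prec (t a) (t b)) ∧
      (∀ i : Fin (r + 1),
        f (t ⟨2 * i.val, by have := i.isLt; omega⟩) <
          f (t ⟨2 * i.val + 1, by have := i.isLt; omega⟩))) :
    ∃ (t : ℕ) (S : Fin t → Set ℕ),
      (∀ n : ℕ, ∃! i : Fin t, n ∈ S i) ∧
      (∀ i j : Fin t, i < j → ∀ a ∈ S i, ∀ b ∈ S j, prec a b) ∧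
      (∀ i : Fin t, ∀ a ∈ S i, ∀ b ∈ S i, f a = f b) := by
  classical
  have hasc : ∀ m p, @HasAscents ℕ ⟨prec⟩ f m p → m ≤ r := by
    rintro m p ⟨t, h1, h2, -⟩
    by_contra hm
    exact h ⟨fun i => t i, fun a b hab => h1 a b hab (by omega),
      fun i => h2 i (by omega)⟩
  obtain ⟨g, B, hmono, hB, hf⟩ :=
    @exists_monotone_of_not_hasAscents ℕ (linearOrderOfSTO prec) f hfin r hasc
  refine ⟨B, fun i => {n | g n = i}, ?_, ?_, ?_⟩
  · exact fun n => ⟨⟨g n, hB n⟩, rfl, fun j hj => Fin.ext (Eq.symm hj)⟩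
  · intro i j hij a ha b hb
    have hlt : g a < g b := by
      rw [Set.mem_ofPred_eq.mp ha, Set.mem_ofPred_eq.mp hb]
      exact hij
    exact @Monotone.reflect_lt ℕ ℕ (linearOrderOfSTO prec) _ g hmono a b hlt
  · exact fun i a ha b hb => hf a b (Eq.trans ha (Eq.symm hb))
end

section
/- Let ≺ be a linear order on ℕ, let r be a natural number, and let f : ℕ → ℤ be a function attaining a maximum value M (i.e., f(s) ≤ M for all s and f(s₀) = M for some s₀). Suppose there is no chain s₀ ≺ s₁ ≺ … ≺ s_{2r+2} of 2r+3 elements of ℕ such that f(s_i) = M for all odd indices i and f(s_i) < M for all even indices i. Then the set B = {s ∈ ℕ : f(s) < M} is a union of at most r+1 subsets of ℕ each of which is ≺-convex. -/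
/-- `AltChainTo prec B k x`: there is a `prec`-chain of length `2 * k + 1` ending at `x` whose
terms alternately lie in `B` and outside `B`, starting and ending in `B`. -/
def AltChainTo {α : Type*} (prec : α → α → Prop) (B : Set α) : ℕ → α → Prop
  | 0, x => x ∈ B
  | k + 1, x => x ∈ B ∧ ∃ y m, AltChainTo prec B k y ∧ prec y m ∧ m ∉ B ∧ prec m x

namespace AltChainTo

variable {α : Type*} {prec : α → α → Prop} {B : Set α}

theorem mem {k : ℕ} {x : α} (hx : AltChainTo prec B k x) : x ∈ B := by
  cases k with
  | zero => exact hx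
  | succ k => exact hx.1

theorem of_prec [IsTrans α prec] {k : ℕ} {x y : α} (hx : AltChainTo prec B k x)
    (hxy : prec x y) (hy : y ∈ B) : AltChainTo prec B k y := by
  cases k with
  | zero => exact hy
  | succ k =>
    obtain ⟨-, z, m, hz, hzm, hm, hmx⟩ := hx
    exact ⟨hy, z, m, hz, hzm, hm, _root_.trans hmx hxy⟩

theorem exists_seq [IsTrans α prec] {k : ℕ} {x : α} (hx : AltChainTo prec B k x) :
    ∃ s : ℕ → α, s (2 * k) = x ∧
      (∀ i j, i < j → j ≤ 2 * k → prec (s i) (s j)) ∧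
      (∀ i ≤ 2 * k, s i ∈ B ↔ Even i) := by
  induction k generalizing x with
  | zero =>
    refine ⟨fun _ => x, rfl, fun i j _ _ => by omega, fun i hi => ?_⟩
    obtain rfl : i = 0 := by omega
    simpa using hx.mem
  | succ k ih =>
    obtain ⟨hxB, y, m, hy, hym, hm, hmx⟩ := hx
    obtain ⟨s, hs, hchain, hB⟩ := ih hy
    have hsm : ∀ i ≤ 2 * k, prec (s i) m := fun i hi => by
      rcases hi.eq_or_lt with rfl | hi
      · rwa [hs]
      · exact _root_.trans (hs ▸ hchain i (2 * k) hi le_rfl) hym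
    refine ⟨fun i => if i ≤ 2 * k then s i else if i = 2 * k + 1 then m else x, ?_, ?_, ?_⟩
    · simp [mul_add]
    · intro i j hij hj
      dsimp only
      split_ifs with h₁ h₂ h₃ h₄ h₅ <;> try omega
      · exact hchain i j hij h₂
      · exact hsm i h₁
      · exact _root_.trans (hsm i h₁) hmx
    · intro i hi
      dsimp only
      split_ifs with h₁ h₂
      · exact hB i h₁
      · simp [hm, h₂]
      · obtain rfl : i = 2 * (k + 1) := by omega
        simp [hxB]

end AltChainTo



/-- Let `prec` be a (strict) linear order on `ℕ` and `f : ℕ → ℤ` attain a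
maximum value `M`. If there is no `prec`-chain `s₀ ≺ s₁ ≺ ⋯ ≺ s_{2r+2}` of
`2r+3` elements with `f sᵢ = M` for odd `i` and `f sᵢ < M` for even `i`, then
`{s | f s < M}` is a union of at most `r + 1` `prec`-convex subsets. -/
theorem stmt_7 (prec : ℕ → ℕ → Prop) (hprec : IsStrictTotalOrder ℕ prec)
    (r : ℕ) (f : ℕ → ℤ) (M : ℤ)
    (hub : ∀ s : ℕ, f s ≤ M) (hmax : ∃ s : ℕ, f s = M)
    (h : ¬ ∃ s : Fin (2 * r + 3) → ℕ,
      (∀ a b : Fin (2 * r + 3), a < b → prec (s a) (s b)) ∧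
      (∀ i : Fin (2 * r + 3), Odd i.val → f (s i) = M) ∧
      (∀ i : Fin (2 * r + 3), Even i.val → f (s i) < M)) :
    ∃ C : Fin (r + 1) → Set ℕ,
      (⋃ i, C i) = {s : ℕ | f s < M} ∧
      (∀ i : Fin (r + 1), ∀ a ∈ C i, ∀ c ∈ C i, ∀ b : ℕ,
        prec a b → prec b c → b ∈ C i) := by
  have hbound : ∀ x, ¬ AltChainTo prec {s | f s < M} (r + 1) x := fun x hx => by
    obtain ⟨s, -, hchain, hB⟩ := hx.exists_seq
    refine h ⟨fun i => s i, fun a b hab => hchain a b hab (by omega), fun i hi => ?_,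
      fun i hi => (hB i (by omega)).2 hi⟩
    have hnot : ¬ f (s i) < M := fun hlt =>
      Nat.not_even_iff_odd.2 hi ((hB i (by omega)).1 hlt)
    exact le_antisymm (hub _) (not_lt.1 hnot)
  refine ⟨fun i => {x | AltChainTo prec {s | f s < M} i x ∧
    ¬ AltChainTo prec {s | f s < M} (i + 1) x}, ?_, ?_⟩
  · ext x
    simp only [Set.mem_iUnion, Set.mem_ofPred_eq]
    refine ⟨fun ⟨i, hi, _⟩ => hi.mem, fun hx => ?_⟩
    by_contra! hstep
    have hall : ∀ k ≤ r + 1, AltChainTo prec {s | f s < M} k x := fun k => by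
      induction k with
      | zero => exact fun _ => hx
      | succ k ih => exact fun hk => hstep ⟨k, by omega⟩ (ih (by omega))
    exact hbound x (hall _ le_rfl)
  · rintro i a ⟨ha, -⟩ c ⟨hc, hc'⟩ b hab hbc
    have hb : f b < M := by
      by_contra hb
      exact hc' ⟨hc.mem, a, b, ha, hab, hb, hbc⟩
    exact ⟨ha.of_prec hab hb, fun hb' => hc' (hb'.of_prec hbc hc.mem)⟩
end

section
/- Let ≺ be a linear order on ℕ and let f : ℕ → ℂ be a function whose range is finite. Suppose there exists a natural number r with the following property: for every finite subset F ⊆ ℕ of cardinality n, listing F in ≺-increasing order as s₁ ≺ s₂ ≺ … ≺ s_n, the sequence g(k) = f(s_k) − k (1 ≤ k ≤ n) contains a subsequence of length at least n − r which is strictly decreasing and all of whose terms have pairwise differences in ℤ. Then f is almost integral (i.e., there is a finite set E ⊆ ℕ such that f(i) − f(j) ∈ ℤ for all i, j ∈ ℕ ∖ E) and f is locally constant with respect to ≺ (i.e., there exists a finite partition ℕ = S₁ ⊔ … ⊔ S_t compatible with ≺ such that f is constant on each S_i). -/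
/-- `AltChain prec f n x`: there is a `prec`-increasing chain of `n + 1` elements ending at `x`
along which consecutive values of `f` differ. -/
def AltChain (prec : ℕ → ℕ → Prop) (f : ℕ → ℂ) : ℕ → ℕ → Prop
  | 0, _ => True
  | n + 1, x => ∃ y, prec y x ∧ f y ≠ f x ∧ AltChain prec f n y

theorem AltChain.exists_seq {prec : ℕ → ℕ → Prop} {f : ℕ → ℂ} {n x : ℕ}
    (h : AltChain prec f n x) :
    ∃ s : ℕ → ℕ, s n = x ∧ ∀ k < n, prec (s k) (s (k + 1)) ∧ f (s k) ≠ f (s (k + 1)) := by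
  induction n generalizing x with
  | zero => exact ⟨fun _ => x, rfl, by simp⟩
  | succ n ih =>
    obtain ⟨y, hy, hf, hc⟩ := h
    obtain ⟨s, hs, hk⟩ := ih hc
    refine ⟨fun i => if i ≤ n then s i else x, by simp, fun k hkn => ?_⟩
    rcases Nat.lt_succ_iff_lt_or_eq.mp hkn with h1 | rfl
    · have h2 : k + 1 ≤ n := h1
      simpa [h1.le, h2] using hk k h1
    · simpa [hs] using ⟨hy, hf⟩

theorem AltChain.of_prec_of_eq {prec : ℕ → ℕ → Prop} [IsTrans ℕ prec] {f : ℕ → ℂ} {n x y : ℕ}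
    (h : AltChain prec f n y) (hyx : prec y x) (hf : f y = f x) : AltChain prec f n x := by
  cases n with
  | zero => trivial
  | succ n =>
    obtain ⟨z, hz, hfz, hc⟩ := h
    exact ⟨z, _root_.trans hz hyx, hf ▸ hfz, hc⟩

theorem prec_of_lt_of_forall_succ {prec : ℕ → ℕ → Prop} [IsTrans ℕ prec] {s : ℕ → ℕ} {n : ℕ}
    (h : ∀ k < n, prec (s k) (s (k + 1))) {a b : ℕ} (hab : a < b) (hb : b ≤ n) :
    prec (s a) (s b) := by
  induction b, hab using Nat.le_induction with
  | base => exact h a hb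
  | succ b _ ih => exact _root_.trans (ih (by omega)) (h b hb)

/-- If lengths of alternating chains are bounded, `f` is locally constant. -/
theorem exists_compatible_partition_of_altChain_bounded {prec : ℕ → ℕ → Prop}
    (hprec : IsStrictTotalOrder ℕ prec) {f : ℕ → ℂ} {N : ℕ}
    (hN : ∀ n x, AltChain prec f n x → n ≤ N) :
    ∃ (t : ℕ) (S : Fin t → Set ℕ),
      (∀ n : ℕ, ∃! i : Fin t, n ∈ S i) ∧
      (∀ i j : Fin t, i < j → ∀ a ∈ S i, ∀ b ∈ S j, prec a b) ∧
      (∀ i : Fin t, ∀ a ∈ S i, ∀ b ∈ S i, f a = f b) := by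
  classical
  let c : ℕ → ℕ := fun x => Nat.findGreatest (fun n => AltChain prec f n x) N
  have hc (x : ℕ) : AltChain prec f (c x) x :=
    Nat.findGreatest_spec (P := fun n => AltChain prec f n x) (Nat.zero_le N) trivial
  have le_c {n x : ℕ} (h : AltChain prec f n x) : n ≤ c x := Nat.le_findGreatest (hN n x h) h
  have hmono {x y : ℕ} (h : prec y x) : c y ≤ c x := by
    by_cases hf : f y = f x
    · exact le_c ((hc y).of_prec_of_eq h hf)
    · exact (Nat.le_succ _).trans (le_c (n := c y + 1) ⟨y, h, hf, hc y⟩)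
  have heq {x y : ℕ} (h : prec y x) (hcc : c y = c x) : f y = f x := by
    by_contra hf
    have := le_c (n := c y + 1) ⟨y, h, hf, hc y⟩
    omega
  refine ⟨N + 1, fun i => {x | c x = i}, fun n => ?_, fun i j hij a ha b hb => ?_,
    fun i a ha b hb => ?_⟩
  · exact ⟨⟨c n, Nat.lt_succ_of_le (Nat.findGreatest_le N)⟩, rfl, fun j hj => Fin.ext hj.symm⟩
  · have hlt : c a < c b := by
      rw [Set.mem_ofPred_eq] at ha hb
      rw [ha, hb]
      exact hij
    rcases trichotomous_of prec a b with h | rfl | h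
    · exact h
    · exact absurd hlt (lt_irrefl _)
    · exact absurd (hmono h) (not_le.mpr hlt)
  · have hcc : c a = c b := ha.trans hb.symm
    rcases trichotomous_of prec a b with h | rfl | h
    · exact heq h hcc
    · rfl
    · exact (heq h hcc.symm).symm

/-- If an injection into `Fin ((r + 1) * L)` misses at most `r` indices, then its range contains
one of the `r + 1` consecutive blocks of length `L`. -/
theorem exists_block_subset_range {r L m : ℕ} {k : Fin m → Fin ((r + 1) * L)}
    (hk : Function.Injective k) (hm : (r + 1) * L - r ≤ m) :
    ∃ q, q + L ≤ (r + 1) * L ∧ ∀ j < L, ∃ a, (k a : ℕ) = q + j := by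
  classical
  have hle (i : Fin (r + 1)) : (i : ℕ) * L + L ≤ (r + 1) * L := by
    rw [← Nat.succ_mul]
    exact Nat.mul_le_mul_right L i.isLt
  by_contra! hcon
  choose j hj hja using fun i : Fin (r + 1) => hcon (i * L) (hle i)
  let e : Fin (r + 1) ⊕ Fin m → Fin ((r + 1) * L) :=
    Sum.elim (fun i => ⟨i * L + j i, by have := hle i; have := hj i; omega⟩) k
  have he : Function.Injective e := by
    refine Function.Injective.sumElim (fun a b hab => ?_) hk fun a b hab => ?_
    · have h1 : (a : ℕ) * L + j a = b * L + j b := congrArg Fin.val hab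
      have hL : 0 < L := (Nat.zero_le _).trans_lt (hj a)
      have h2 := congrArg (· / L) h1
      simp only [mul_comm _ L, Nat.mul_add_div hL, Nat.div_eq_of_lt (hj a),
        Nat.div_eq_of_lt (hj b), add_zero] at h2
      exact Fin.ext h2
    · exact hja a b (congrArg Fin.val hab).symm
  have := Fintype.card_le_of_injective e he
  simp only [Fintype.card_sum, Fintype.card_fin] at this
  omega

/-- If `u k - k` decreases by positive integers between consecutive indices of a block of length
`L` and consecutive values of `u` differ, then `u` decreases by positive integers there. -/
theorem exists_pos_int_sub_of_block {u : ℕ → ℂ} {q L : ℕ}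
    (hne : ∀ i, i + 1 < L → u (q + i) ≠ u (q + (i + 1)))
    (hdec : ∀ i, i + 1 < L → ∃ z : ℤ, 0 < z ∧ u (q + i) + 1 - u (q + (i + 1)) = (z : ℂ))
    {i j : ℕ} (hij : i < j) (hj : j < L) :
    ∃ z : ℤ, 0 < z ∧ u (q + i) - u (q + j) = (z : ℂ) := by
  have hstep (i : ℕ) (hi : i + 1 < L) :
      ∃ z : ℤ, 0 < z ∧ u (q + i) - u (q + (i + 1)) = (z : ℂ) := by
    obtain ⟨z, hz, h⟩ := hdec i hi
    have h' : u (q + i) - u (q + (i + 1)) = ((z - 1 : ℤ) : ℂ) := by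
      push_cast
      linear_combination h
    refine ⟨z - 1, lt_of_le_of_ne (by omega) fun h0 => hne i hi ?_, h'⟩
    rw [← h0, Int.cast_zero] at h'
    exact sub_eq_zero.mp h'
  induction j, hij using Nat.le_induction with
  | base => exact hstep i hj
  | succ j _ ih =>
    obtain ⟨z, hz, h⟩ := ih (by omega)
    obtain ⟨w, hw, h'⟩ := hstep j hj
    refine ⟨z + w, by omega, ?_⟩
    push_cast
    linear_combination h + h'

/-- The hypothesis that, along every finite increasing list, `f (s k) - k` has a strictly
decreasing subsequence with integer differences omitting at most `r` terms. -/
def HasLongDecreasing (prec : ℕ → ℕ → Prop) (f : ℕ → ℂ) (r : ℕ) : Prop :=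
  ∀ (n : ℕ) (s : Fin n → ℕ),
    (∀ a b : Fin n, a < b → prec (s a) (s b)) →
    ∃ (m : ℕ) (k : Fin m → Fin n), n - r ≤ m ∧ StrictMono k ∧
      (∀ a b : Fin m, a < b → ∃ z : ℤ, 0 < z ∧
        (f (s (k a)) - (((k a : ℕ) : ℂ) + 1)) -
          (f (s (k b)) - (((k b : ℕ) : ℂ) + 1)) = (z : ℂ))

theorem HasLongDecreasing.altChain_bounded {prec : ℕ → ℕ → Prop} [IsTrans ℕ prec] {f : ℕ → ℂ}
    {r : ℕ} (h : HasLongDecreasing prec f r) (hfin : (Set.range f).Finite) {n x : ℕ}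
    (hn : AltChain prec f n x) : n ≤ (r + 1) * ((Set.range f).ncard + 1) := by
  by_contra! hlt
  set L := (Set.range f).ncard + 1 with hL
  obtain ⟨s, -, hs⟩ := hn.exists_seq
  obtain ⟨m, k, hm, hk, hdec⟩ := h ((r + 1) * L) (fun a => s a) fun a b hab =>
    prec_of_lt_of_forall_succ (fun k hk => (hs k hk).1) hab (b.isLt.le.trans hlt.le)
  obtain ⟨q, hq, hblock⟩ := exists_block_subset_range hk.injective hm
  have hpos {i j : ℕ} (hij : i < j) (hj : j < L) :
      ∃ z : ℤ, 0 < z ∧ f (s (q + i)) - f (s (q + j)) = (z : ℂ) := by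
    refine exists_pos_int_sub_of_block (u := fun i => f (s i))
      (fun i hi => (hs (q + i) (by omega)).2) (fun i hi => ?_) hij hj
    obtain ⟨a, ha⟩ := hblock i (by omega)
    obtain ⟨b, hb⟩ := hblock (i + 1) hi
    have hab : a < b := hk.lt_iff_lt.mp (Fin.lt_def.mpr (by omega))
    obtain ⟨z, hz, hzz⟩ := hdec a b hab
    refine ⟨z, hz, ?_⟩
    rw [ha, hb] at hzz
    push_cast at hzz
    linear_combination hzz
  have hne {i j : ℕ} (hij : i < j) (hj : j < L) : f (s (q + i)) ≠ f (s (q + j)) := by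
    intro heq
    obtain ⟨z, hz, hzz⟩ := hpos hij hj
    rw [heq, sub_self] at hzz
    exact hz.ne (by exact_mod_cast hzz)
  have hinj : Set.InjOn (fun i => f (s (q + i))) (Finset.range L : Set ℕ) := by
    intro i hi j hj hij
    rw [Finset.mem_coe, Finset.mem_range] at hi hj
    rcases lt_trichotomy i j with hlt | heq | hlt
    · exact absurd hij (hne hlt hj)
    · exact heq
    · exact absurd hij.symm (hne hlt hi)
  have := Set.ncard_le_ncard_of_injOn (s := (Finset.range L : Set ℕ)) (t := Set.range f) _
    (fun i _ => Set.mem_range_self (s (q + i))) hinj hfin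
  rw [Set.ncard_coe_finset, Finset.card_range] at this
  omega

theorem exists_increasing_enumeration {α : Type*} {prec : α → α → Prop}
    (hprec : IsStrictTotalOrder α prec) (F : Finset α) :
    ∃ s : Fin F.card → α, Function.Injective s ∧ (∀ a, s a ∈ F) ∧
      ∀ a b : Fin F.card, a < b → prec (s a) (s b) := by
  classical
  let _ : LinearOrder α := linearOrderOfSTO prec
  exact ⟨F.orderEmbOfFin rfl, (F.orderEmbOfFin rfl).injective, F.orderEmbOfFin_mem rfl,
    fun _ _ hab => (F.orderEmbOfFin rfl).strictMono hab⟩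

/-- Every finite set of naturals contains all but `r` elements in a single class modulo `ℤ`. -/
theorem HasLongDecreasing.exists_subset_int_sub {prec : ℕ → ℕ → Prop}
    (hprec : IsStrictTotalOrder ℕ prec) {f : ℕ → ℂ} {r : ℕ} (h : HasLongDecreasing prec f r)
    (F : Finset ℕ) :
    ∃ G ⊆ F, F.card ≤ G.card + r ∧ ∀ x ∈ G, ∀ y ∈ G, ∃ z : ℤ, f x - f y = (z : ℂ) := by
  classical
  obtain ⟨s, hinj, hmem, hmono⟩ := exists_increasing_enumeration hprec F
  obtain ⟨m, k, hm, hk, hdec⟩ := h F.card s hmono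
  refine ⟨Finset.univ.image (s ∘ k), ?_, ?_, ?_⟩
  · intro x hx
    obtain ⟨a, -, rfl⟩ := Finset.mem_image.mp hx
    exact hmem _
  · rw [Finset.card_image_of_injective _ (hinj.comp hk.injective),
      Finset.card_univ, Fintype.card_fin]
    exact Nat.sub_le_iff_le_add.mp hm
  · intro x hx y hy
    obtain ⟨a, -, rfl⟩ := Finset.mem_image.mp hx
    obtain ⟨b, -, rfl⟩ := Finset.mem_image.mp hy
    rcases lt_trichotomy a b with hlt | heq | hlt
    · obtain ⟨z, -, hz⟩ := hdec a b hlt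
      refine ⟨z + (k a : ℕ) - (k b : ℕ), ?_⟩
      push_cast [Function.comp_apply]
      linear_combination hz
    · exact ⟨0, by rw [heq]; simp⟩
    · obtain ⟨z, -, hz⟩ := hdec b a hlt
      refine ⟨-z + (k a : ℕ) - (k b : ℕ), ?_⟩
      push_cast [Function.comp_apply]
      linear_combination -hz

theorem HasLongDecreasing.almost_integral {prec : ℕ → ℕ → Prop}
    (hprec : IsStrictTotalOrder ℕ prec) {f : ℕ → ℂ} {r : ℕ} (h : HasLongDecreasing prec f r)
    (hfin : (Set.range f).Finite) :
    ∃ E : Finset ℕ, ∀ i j : ℕ, i ∉ E → j ∉ E → ∃ z : ℤ, f i - f j = (z : ℂ) := by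
  classical
  have := hfin.to_subtype
  obtain ⟨⟨v, hv⟩, hinf⟩ := Finite.exists_infinite_fiber (Set.rangeFactorization f)
  rw [Set.infinite_coe_iff] at hinf
  let B : Set ℕ := {x | ¬ ∃ z : ℤ, f x - v = (z : ℂ)}
  have hB : B.Finite := by
    by_contra hBinf
    obtain ⟨P, hP, hPc⟩ := hinf.exists_subset_card_eq (r + 1)
    obtain ⟨Q, hQ, hQc⟩ := Set.Infinite.exists_subset_card_eq hBinf (r + 1)
    have hPv (x : ℕ) (hx : x ∈ P) : f x = v := congrArg Subtype.val (hP hx)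
    have hdisj : Disjoint P Q := Finset.disjoint_left.mpr fun x hxP hxQ =>
      hQ hxQ ⟨0, by simp [hPv x hxP]⟩
    obtain ⟨G, hG, hGc, hGz⟩ := h.exists_subset_int_sub hprec (P ∪ Q)
    rw [Finset.card_union_of_disjoint hdisj, hPc, hQc] at hGc
    have hGP : ∃ x ∈ G, x ∈ P := by
      by_contra! hcon
      have := Finset.card_le_card (s := G) (t := Q) fun x hx =>
        (Finset.mem_union.mp (hG hx)).resolve_left (hcon x hx)
      omega
    have hGQ : ∃ x ∈ G, x ∈ Q := by
      by_contra! hcon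
      have := Finset.card_le_card (s := G) (t := P) fun x hx =>
        (Finset.mem_union.mp (hG hx)).resolve_right (hcon x hx)
      omega
    obtain ⟨x, hxG, hxP⟩ := hGP
    obtain ⟨y, hyG, hyQ⟩ := hGQ
    exact hQ hyQ (hPv x hxP ▸ hGz y hyG x hxG)
  refine ⟨hB.toFinset, fun i j hi hj => ?_⟩
  simp only [Set.Finite.mem_toFinset, B, Set.mem_ofPred_eq, not_not] at hi hj
  obtain ⟨z, hz⟩ := hi
  obtain ⟨w, hw⟩ := hj
  refine ⟨z - w, ?_⟩
  push_cast
  linear_combination hz - hw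


/-- Let `prec` be a (strict) linear order on `ℕ` and `f : ℕ → ℂ` have finite
range. Suppose there exists `r : ℕ` such that for every finite subset of `ℕ`,
listed in `prec`-increasing order as `s₁ ≺ ⋯ ≺ s_n`, the sequence
`g k = f (s k) - k` contains a subsequence of length at least `n - r` that is
strictly decreasing with pairwise integer differences. Then `f` is almost
integral and locally constant with respect to `prec`. -/
theorem stmt_8 (prec : ℕ → ℕ → Prop) (hprec : IsStrictTotalOrder ℕ prec)
    (f : ℕ → ℂ) (hfin : (Set.range f).Finite)
    (h : ∃ r : ℕ, ∀ (n : ℕ) (s : Fin n → ℕ),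
      (∀ a b : Fin n, a < b → prec (s a) (s b)) →
      ∃ (m : ℕ) (k : Fin m → Fin n), n - r ≤ m ∧ StrictMono k ∧
        (∀ a b : Fin m, a < b → ∃ z : ℤ, 0 < z ∧
          (f (s (k a)) - (((k a : ℕ) : ℂ) + 1)) -
            (f (s (k b)) - (((k b : ℕ) : ℂ) + 1)) = (z : ℂ))) :
    (∃ E : Finset ℕ, ∀ i j : ℕ, i ∉ E → j ∉ E → ∃ z : ℤ, f i - f j = (z : ℂ)) ∧
    (∃ (t : ℕ) (S : Fin t → Set ℕ),
      (∀ n : ℕ, ∃! i : Fin t, n ∈ S i) ∧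
      (∀ i j : Fin t, i < j → ∀ a ∈ S i, ∀ b ∈ S j, prec a b) ∧
      (∀ i : Fin t, ∀ a ∈ S i, ∀ b ∈ S i, f a = f b)) := by
  obtain ⟨r, hr⟩ := h
  have hr' : HasLongDecreasing prec f r := hr
  exact ⟨hr'.almost_integral hprec hfin, exists_compatible_partition_of_altChain_bounded hprec
    fun _ _ hn => hr'.altChain_bounded hfin hn⟩
end
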